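/- arXiv:1507.01449 — 2 statements merged into one kernel-verified Lean document; each statement's English description precedes it below -/
import Mathlib

section
/- Let D ⊂ ℝ² be a bounded open set, let f : ℝ² → ℝ be integrable on D with ∫_D |f| > 0, and let u : ℝ² → ℝ be continuous on the closure of D, twice continuously differentiable on D, satisfy -Δu(x) = f(x) for every x ∈ D, and u(x) = 0 for every x in the topological boundary of D. Then for every δ ∈ (0, 4π) one has ∫_D exp( (4π - δ)·|u(x)| / ∫_D |f| ) dx ≤ (4π²/δ)·(diam D)². -/
open MeasureTheory Real

theorem contDiff_fderiv_apply {E : Type*} [NormedAddCommGroup E] [NormedSpace ℝ E] {g : E → ℝ}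
    (hg : ContDiff ℝ 2 g) (e : E) : ContDiff ℝ 1 (fun z => fderiv ℝ g z e) :=
  (hg.fderiv_right (m := 1) (by norm_num)).clm_apply contDiff_const

theorem continuous_fderiv_fderiv_apply {E : Type*} [NormedAddCommGroup E] [NormedSpace ℝ E]
    {g : E → ℝ} (hg : ContDiff ℝ 2 g) (e : E) :
    Continuous (fun y => fderiv ℝ (fun z => fderiv ℝ g z e) y e) :=
  ((contDiff_fderiv_apply hg e).continuous_fderiv (by norm_num)).clm_apply continuous_const

theorem volume_real_ball_zero_one :
    volume.real (Metric.ball (0 : EuclideanSpace ℝ (Fin 2)) 1) = π := by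
  simp [measureReal_def, pi_pos.le]

theorem integral_mul_fderiv_fderiv_eq {E : Type*} [NormedAddCommGroup E] [NormedSpace ℝ E]
    [FiniteDimensional ℝ E] [MeasurableSpace E] [BorelSpace E] {μ : Measure E}
    [μ.IsAddHaarMeasure] {G w : E → ℝ} (hG : ContDiff ℝ 2 G) (hw : ContDiff ℝ 2 w)
    (hw_supp : HasCompactSupport w) (e : E) :
    ∫ y, G y * fderiv ℝ (fun z => fderiv ℝ w z e) y e ∂μ =
      ∫ y, fderiv ℝ (fun z => fderiv ℝ G z e) y e * w y ∂μ := by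
  have hG' : ContDiff ℝ 1 (fun z => fderiv ℝ G z e) := contDiff_fderiv_apply hG e
  have hw' : ContDiff ℝ 1 (fun z => fderiv ℝ w z e) := contDiff_fderiv_apply hw e
  have hG'' := continuous_fderiv_fderiv_apply hG e
  have hw'' := continuous_fderiv_fderiv_apply hw e
  have hs' : HasCompactSupport (fun z => fderiv ℝ w z e) := hw_supp.fderiv_apply ℝ e
  have hs'' : HasCompactSupport (fun y => fderiv ℝ (fun z => fderiv ℝ w z e) y e) :=
    hs'.fderiv_apply ℝ e
  have h {g k : E → ℝ} (hg : Continuous g) (hk : Continuous k) (hks : HasCompactSupport k) :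
      Integrable (fun y => g y * k y) μ :=
    (hg.mul hk).integrable_of_hasCompactSupport hks.mul_left
  rw [integral_mul_fderiv_eq_neg_fderiv_mul_of_integrable
      (h hG'.continuous hw'.continuous hs') (h hG.continuous hw'' hs'')
      (h hG.continuous hw'.continuous hs')
      (fun x _ => hG.differentiable (by norm_num) x)
      (fun x _ => hw'.differentiable (by norm_num) x),
    integral_mul_fderiv_eq_neg_fderiv_mul_of_integrable
      (h hG'' hw.continuous hw_supp) (h hG'.continuous hw'.continuous hs')
      (h hG'.continuous hw.continuous hw_supp)
      (fun x _ => hG'.differentiable (by norm_num) x)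
      (fun x _ => hw.differentiable (by norm_num) x), neg_neg]

/-- The Laplacian of a function on the plane, as the sum of its pure second partial derivatives. -/
noncomputable def planeLaplacian (w : EuclideanSpace ℝ (Fin 2) → ℝ)
    (x : EuclideanSpace ℝ (Fin 2)) : ℝ :=
  ∑ i : Fin 2, fderiv ℝ (fun y => fderiv ℝ w y (EuclideanSpace.single i 1)) x
    (EuclideanSpace.single i 1)

theorem continuous_planeLaplacian {w : EuclideanSpace ℝ (Fin 2) → ℝ} (hw : ContDiff ℝ 2 w) :
    Continuous (planeLaplacian w) :=
  continuous_finsetSum _ fun i _ => continuous_fderiv_fderiv_apply hw (EuclideanSpace.single i 1)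

theorem integral_mul_planeLaplacian_eq {G w : EuclideanSpace ℝ (Fin 2) → ℝ}
    (hG : ContDiff ℝ 2 G) (hw : ContDiff ℝ 2 w) (hw_supp : HasCompactSupport w) :
    ∫ y, G y * planeLaplacian w y = ∫ y, planeLaplacian G y * w y := by
  simp only [planeLaplacian, Finset.mul_sum, Finset.sum_mul]
  rw [integral_finsetSum, integral_finsetSum]
  · exact Finset.sum_congr rfl fun i _ => integral_mul_fderiv_fderiv_eq hG hw hw_supp _
  · exact fun i _ => ((continuous_fderiv_fderiv_apply hG _).mul
      hw.continuous).integrable_of_hasCompactSupport hw_supp.mul_left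
  · exact fun i _ => (hG.continuous.mul
      (continuous_fderiv_fderiv_apply hw _)).integrable_of_hasCompactSupport
        ((hw_supp.fderiv_apply ℝ _).fderiv_apply ℝ _).mul_left

/-- A smooth approximation of `y ↦ log (d / ‖x - y‖)`, converging to it as `c → ∞`. -/
noncomputable def logKernel (c d : ℝ) (x y : EuclideanSpace ℝ (Fin 2)) : ℝ :=
  (1 / 2) * log (1 + c ^ 2 * d ^ 2) - (1 / 2) * log (1 + c ^ 2 * ‖x - y‖ ^ 2)

theorem contDiff_logKernel (c d : ℝ) (x : EuclideanSpace ℝ (Fin 2)) :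
    ContDiff ℝ 2 (logKernel c d x) := by
  unfold logKernel
  refine contDiff_const.sub (contDiff_const.mul (ContDiff.log ?_ fun y => by positivity))
  exact contDiff_const.add (contDiff_const.mul ((contDiff_const.sub contDiff_id).norm_sq ℝ))

theorem logKernel_nonneg {c d : ℝ} {x y : EuclideanSpace ℝ (Fin 2)} (h : ‖x - y‖ ≤ d) :
    0 ≤ logKernel c d x y := by
  have : log (1 + c ^ 2 * ‖x - y‖ ^ 2) ≤ log (1 + c ^ 2 * d ^ 2) := by gcongr
  unfold logKernel; linarith

theorem logKernel_le {c d : ℝ} (x y : EuclideanSpace ℝ (Fin 2)) :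
    logKernel c d x y ≤ (1 / 2) * log (1 + c ^ 2 * d ^ 2) := by
  have : 0 ≤ log (1 + c ^ 2 * ‖x - y‖ ^ 2) := log_nonneg (le_add_of_nonneg_right (by positivity))
  unfold logKernel; linarith

theorem logKernel_le_log {c d : ℝ} {x y : EuclideanSpace ℝ (Fin 2)} (hxy : x ≠ y)
    (h : ‖x - y‖ ≤ d) : logKernel c d x y ≤ log (d / ‖x - y‖) := by
  have hr : 0 < ‖x - y‖ := norm_pos_iff.2 (sub_ne_zero.2 hxy)
  have hd : 0 < d := hr.trans_le h
  have h1 : log (1 + c ^ 2 * d ^ 2) + 2 * log ‖x - y‖ ≤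
      2 * log d + log (1 + c ^ 2 * ‖x - y‖ ^ 2) := by
    have e (a : ℝ) : 2 * log a = log (a ^ 2) := by rw [log_pow]; norm_num
    rw [e, e, ← log_mul (by positivity) (by positivity), ← log_mul (by positivity) (by positivity)]
    have : ‖x - y‖ ^ 2 ≤ d ^ 2 := by gcongr
    exact log_le_log (by positivity) (by linarith)
  rw [log_div hd.ne' hr.ne']
  unfold logKernel; linarith

theorem planeLaplacian_logKernel (c d : ℝ) (x y : EuclideanSpace ℝ (Fin 2)) :
    planeLaplacian (logKernel c d x) y = -(2 * c ^ 2 / (1 + c ^ 2 * ‖x - y‖ ^ 2) ^ 2) := by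
  have hq (y) : HasFDerivAt (fun y => 1 + c ^ 2 * ‖x - y‖ ^ 2)
      ((-2 * c ^ 2) • innerSL ℝ (x - y)) y := by
    have := ((((hasFDerivAt_id y).const_sub x).norm_sq).const_mul (c ^ 2)).const_add 1
    convert! this using 1
    ext v
    simp
    ring
  have h1 (i : Fin 2) : (fun y => fderiv ℝ (logKernel c d x) y (EuclideanSpace.single i 1)) =
      fun y => c ^ 2 * (x i - y i) / (1 + c ^ 2 * ‖x - y‖ ^ 2) := by
    ext y
    have := (((hq y).log (by positivity)).const_mul (1 / 2)).const_sub
      ((1 / 2) * log (1 + c ^ 2 * d ^ 2))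
    rw [show logKernel c d x = fun y => (1 / 2) * log (1 + c ^ 2 * d ^ 2) -
      (1 / 2) * log (1 + c ^ 2 * ‖x - y‖ ^ 2) from rfl, this.fderiv]
    simp [EuclideanSpace.inner_single_right]
    field_simp
  have h2 (i : Fin 2) : fderiv ℝ (fun y => c ^ 2 * (x i - y i) / (1 + c ^ 2 * ‖x - y‖ ^ 2)) y
      (EuclideanSpace.single i 1) = - c ^ 2 / (1 + c ^ 2 * ‖x - y‖ ^ 2) +
        2 * c ^ 4 * (x i - y i) ^ 2 / (1 + c ^ 2 * ‖x - y‖ ^ 2) ^ 2 := by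
    have hp : HasFDerivAt (fun y : EuclideanSpace ℝ (Fin 2) => c ^ 2 * (x i - y i))
        (c ^ 2 • (-(EuclideanSpace.proj i : EuclideanSpace ℝ (Fin 2) →L[ℝ] ℝ))) y :=
      (((EuclideanSpace.proj i : EuclideanSpace ℝ (Fin 2) →L[ℝ] ℝ).hasFDerivAt).const_sub
        (x i)).const_mul (c ^ 2)
    have hne : 1 + c ^ 2 * ‖x - y‖ ^ 2 ≠ 0 := by positivity
    have hinv := (hasDerivAt_inv hne).comp_hasFDerivAt y (hq y)
    simp only [div_eq_mul_inv]
    refine (congrArg (fun l => l (EuclideanSpace.single i 1)) (hp.mul hinv).fderiv).trans ?_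
    simp [EuclideanSpace.inner_single_right]
    field_simp
    ring
  have hn : ‖x - y‖ ^ 2 = (x 0 - y 0) ^ 2 + (x 1 - y 1) ^ 2 := by
    simp [EuclideanSpace.norm_sq_eq]
  simp only [planeLaplacian, h1, h2, Fin.sum_univ_two]
  have : (1 + c ^ 2 * ‖x - y‖ ^ 2) ≠ 0 := by positivity
  field_simp
  rw [hn]
  ring

theorem integral_sq_inv_one_add_norm_sq :
    ∫ z : EuclideanSpace ℝ (Fin 2), π⁻¹ * ((1 + ‖z‖ ^ 2) ^ 2)⁻¹ = 1 := by
  rw [integral_const_mul, integral_fun_norm_addHaar volume (fun r : ℝ => ((1 + r ^ 2) ^ 2)⁻¹)]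
  have hI : ∫ r in Set.Ioi (0 : ℝ), r ^ (2 - 1) • ((1 + r ^ 2) ^ 2)⁻¹ = 1 / 2 := by
    have hd (r : ℝ) : HasDerivAt (fun r : ℝ => -(1 / 2) * (1 + r ^ 2)⁻¹)
        (r ^ (2 - 1) • ((1 + r ^ 2) ^ 2)⁻¹) r := by
      have := ((((hasDerivAt_id r).pow 2).const_add 1).inv
        (by simp; positivity)).const_mul (-(1 / 2 : ℝ))
      convert! this using 1
      simp
      field_simp
    have ht : Filter.Tendsto (fun r : ℝ => -(1 / 2) * (1 + r ^ 2)⁻¹) Filter.atTop (nhds 0) := by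
      have : Filter.Tendsto (fun r : ℝ => 1 + r ^ 2) Filter.atTop Filter.atTop :=
        Filter.tendsto_atTop_add_const_left _ _ (Filter.tendsto_pow_atTop two_ne_zero)
      simpa using this.inv_tendsto_atTop.const_mul (-(1 / 2 : ℝ))
    rw [integral_Ioi_of_hasDerivAt_of_nonneg' (fun r _ => hd r)
      (fun r hr => by have : 0 < r := hr; simp; positivity) ht]
    norm_num
  rw [finrank_euclideanSpace_fin, volume_real_ball_zero_one, hI]
  simp
  field_simp

theorem tendsto_integral_peak {w : EuclideanSpace ℝ (Fin 2) → ℝ} (hw : Continuous w)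
    (hw_int : Integrable w) (x : EuclideanSpace ℝ (Fin 2)) :
    Filter.Tendsto (fun c : ℝ => ∫ y, (2 * c ^ 2 / (1 + c ^ 2 * ‖x - y‖ ^ 2) ^ 2) * w y)
      Filter.atTop (nhds (2 * π * w x)) := by
  have ht : Filter.Tendsto (fun z : EuclideanSpace ℝ (Fin 2) =>
      ‖z‖ ^ Module.finrank ℝ (EuclideanSpace ℝ (Fin 2)) * (π⁻¹ * ((1 + ‖z‖ ^ 2) ^ 2)⁻¹))
      (Bornology.cobounded _) (nhds 0) := by
    have h1 : Filter.Tendsto (fun r : ℝ => π⁻¹ * (r ^ 2)⁻¹) Filter.atTop (nhds 0) := by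
      simpa using (Filter.tendsto_pow_atTop (α := ℝ) two_ne_zero).inv_tendsto_atTop.const_mul π⁻¹
    refine squeeze_zero' (.of_forall fun z => by positivity) ?_
      (h1.comp tendsto_norm_cobounded_atTop)
    filter_upwards [tendsto_norm_cobounded_atTop.eventually_ge_atTop 1] with z hz
    have hz' : 0 < ‖z‖ := by linarith
    rw [finrank_euclideanSpace_fin, Function.comp, ← mul_assoc, mul_comm (_ ^ 2), mul_assoc]
    gcongr
    rw [← div_eq_mul_inv, inv_eq_one_div, div_le_div_iff₀ (by positivity) (by positivity)]
    nlinarith [sq_nonneg (‖z‖ ^ 2)]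
  have := (tendsto_integral_comp_smul_smul_of_integrable' (μ := volume)
    (φ := fun z : EuclideanSpace ℝ (Fin 2) => π⁻¹ * ((1 + ‖z‖ ^ 2) ^ 2)⁻¹)
    (fun z => by positivity) integral_sq_inv_one_add_norm_sq ht hw_int
    (hw.continuousAt (x := x))).const_mul (2 * π)
  refine this.congr fun c => ?_
  rw [← integral_const_mul]
  congr 1 with y
  have : 1 + c ^ 2 * ‖x - y‖ ^ 2 ≠ 0 := by positivity
  simp only [finrank_euclideanSpace_fin, norm_smul, mul_pow, norm_eq_abs, sq_abs, smul_eq_mul]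
  field_simp

/-- A convex `C²` function vanishing on `(-∞, ε]`, with slope at most one, close to `max t 0`. -/
theorem exists_convex_cutoff {ε : ℝ} (hε : 0 < ε) : ∃ φ : ℝ → ℝ, ContDiff ℝ 2 φ ∧
    (∀ t ≤ ε, φ t = 0) ∧ (∀ t, t - 2 * ε ≤ φ t) ∧ (∀ t, 0 ≤ deriv φ t) ∧ (∀ t, deriv φ t ≤ 1) ∧
    ∀ t, 0 ≤ deriv (deriv φ) t := by
  set g : ℝ → ℝ := fun t => smoothTransition ((t - ε) / ε) with hg
  have hgc : ContDiff ℝ 1 g := (smoothTransition.contDiff (n := 1)).comp (by fun_prop)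
  have hφ (t : ℝ) : HasDerivAt (fun t => ∫ s in ε..t, g s) (g t) t :=
    intervalIntegral.integral_hasDerivAt_right (hgc.continuous.intervalIntegrable _ _)
      (hgc.continuous.stronglyMeasurableAtFilter _ _) hgc.continuous.continuousAt
  have hd : deriv (fun t => ∫ s in ε..t, g s) = g := funext fun t => (hφ t).deriv
  have hz : ∀ t ≤ ε, g t = 0 := fun t ht =>
    smoothTransition.zero_of_nonpos (div_nonpos_of_nonpos_of_nonneg (by linarith) hε.le)
  have h0 : ∀ t ≤ ε, ∫ s in ε..t, g s = 0 := by
    intro t ht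
    rw [intervalIntegral.integral_symm, intervalIntegral.integral_congr (g := fun _ => 0)]
    · simp
    · intro s hs
      rw [Set.uIcc_of_le ht] at hs
      exact hz s hs.2
  have hmono : Monotone fun t => ∫ s in ε..t, g s :=
    monotone_of_deriv_nonneg (fun t => (hφ t).differentiableAt)
      fun t => by rw [hd]; exact smoothTransition.nonneg _
  refine ⟨fun t => ∫ s in ε..t, g s, ?_, h0, ?_, ?_, ?_, ?_⟩
  · rw [show (2 : WithTop ℕ∞) = 1 + 1 by norm_num, contDiff_succ_iff_deriv, hd]
    exact ⟨fun t => (hφ t).differentiableAt, by simp, hgc⟩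
  · intro t
    have hφ0 : ∀ t, 0 ≤ ∫ s in ε..t, g s := fun t => by
      rcases le_total t ε with h | h
      · exact (h0 t h).ge
      · simpa using hmono h
    rcases le_total t (2 * ε) with h | h
    · linarith [hφ0 t]
    · have hadd := intervalIntegral.integral_add_adjacent_intervals
        (hgc.continuous.intervalIntegrable (μ := volume) ε (2 * ε))
        (hgc.continuous.intervalIntegrable (μ := volume) (2 * ε) t)
      have h1 : ∫ s in (2 * ε)..t, g s = t - 2 * ε := by
        rw [intervalIntegral.integral_congr (g := fun _ => 1)]
        · simp
        · intro s hs
          rw [Set.uIcc_of_le h] at hs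
          exact smoothTransition.one_of_one_le ((one_le_div hε).2 (by linarith [hs.1]))
      change _ ≤ ∫ s in ε..t, g s
      linarith [hφ0 (2 * ε)]
  · rw [hd]; exact fun t => smoothTransition.nonneg _
  · rw [hd]; exact fun t => smoothTransition.le_one _
  · rw [hd]
    have : Monotone g := fun s t hst => smoothTransition.monotone (by gcongr)
    exact fun t => this.deriv_nonneg

theorem planeLaplacian_congr {w v : EuclideanSpace ℝ (Fin 2) → ℝ} {x : EuclideanSpace ℝ (Fin 2)}
    (h : w =ᶠ[nhds x] v) : planeLaplacian w x = planeLaplacian v x := by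
  refine Finset.sum_congr rfl fun i _ => ?_
  have : (fun y => fderiv ℝ w y (EuclideanSpace.single i 1)) =ᶠ[nhds x]
      fun y => fderiv ℝ v y (EuclideanSpace.single i 1) := by
    filter_upwards [h.fderiv (𝕜 := ℝ)] with y hy
    rw [hy]
  rw [this.fderiv_eq]

theorem planeLaplacian_neg (w : EuclideanSpace ℝ (Fin 2) → ℝ) (x : EuclideanSpace ℝ (Fin 2)) :
    planeLaplacian (-w) x = -planeLaplacian w x := by
  simp [planeLaplacian, fderiv_neg, add_comm]

theorem planeLaplacian_comp {u : EuclideanSpace ℝ (Fin 2) → ℝ} {φ : ℝ → ℝ}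
    {x : EuclideanSpace ℝ (Fin 2)} (hφ : ContDiff ℝ 2 φ) (hu : ContDiffAt ℝ 2 u x) :
    planeLaplacian (φ ∘ u) x = deriv (deriv φ) (u x) *
      ∑ i : Fin 2, (fderiv ℝ u x (EuclideanSpace.single i 1)) ^ 2 +
      deriv φ (u x) * planeLaplacian u x := by
  have hφ' : ContDiff ℝ 1 (deriv φ) := by
    rw [show (2 : WithTop ℕ∞) = 1 + 1 by norm_num, contDiff_succ_iff_deriv] at hφ
    exact hφ.2.2
  have hux : DifferentiableAt ℝ u x := hu.differentiableAt (by norm_num)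
  simp only [planeLaplacian, Finset.mul_sum]
  rw [← Finset.sum_add_distrib]
  refine Finset.sum_congr rfl fun i _ => ?_
  have h1 : (fun y => fderiv ℝ (φ ∘ u) y (EuclideanSpace.single i 1)) =ᶠ[nhds x]
      fun y => deriv φ (u y) * fderiv ℝ u y (EuclideanSpace.single i 1) := by
    filter_upwards [hu.eventually (by simp)] with y hy
    have := ((hφ.differentiable (by norm_num) (u y)).hasDerivAt.comp_hasFDerivAt y
      (hy.differentiableAt (by norm_num)).hasFDerivAt).fderiv
    rw [this]
    simp
  have hu' : DifferentiableAt ℝ (fun y => fderiv ℝ u y (EuclideanSpace.single i 1)) x :=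
    ((hu.fderiv_right (m := 1) (by norm_num)).clm_apply contDiffAt_const).differentiableAt
      (by norm_num)
  have h2 : HasFDerivAt (fun y => deriv φ (u y)) (deriv (deriv φ) (u x) • fderiv ℝ u x) x :=
    (hφ'.differentiable (by norm_num) (u x)).hasDerivAt.comp_hasFDerivAt x hux.hasFDerivAt
  rw [h1.fderiv_eq]
  refine (congrArg (fun l => l (EuclideanSpace.single i 1))
    (h2.mul hu'.hasFDerivAt).fderiv).trans ?_
  simp
  ring

theorem exists_contDiff_hasCompactSupport_approx {D : Set (EuclideanSpace ℝ (Fin 2))}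
    (hD_open : IsOpen D) (hD_bdd : Bornology.IsBounded D) {u : EuclideanSpace ℝ (Fin 2) → ℝ}
    (hu_cont : ContinuousOn u (closure D)) (hu_C2 : ContDiffOn ℝ 2 u D)
    (hu_bd : ∀ x ∈ frontier D, u x = 0) {ε : ℝ} (hε : 0 < ε) :
    ∃ w : EuclideanSpace ℝ (Fin 2) → ℝ, ContDiff ℝ 2 w ∧ HasCompactSupport w ∧
      (∀ x ∈ D, u x - 2 * ε ≤ w x) ∧
      (∀ x ∈ D, -planeLaplacian w x ≤ |planeLaplacian u x|) ∧
      ∀ x ∉ D, planeLaplacian w x = 0 := by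
  classical
  obtain ⟨φ, hφ, hφ0, hφ_ge, hφ_nonneg, hφ_le, hφ_convex⟩ := exists_convex_cutoff hε
  set w : EuclideanSpace ℝ (Fin 2) → ℝ := D.indicator (φ ∘ u) with hw
  set K : Set (EuclideanSpace ℝ (Fin 2)) := closure D ∩ u ⁻¹' Set.Ici ε with hK
  have hK_closed : IsClosed K := hu_cont.preimage_isClosed_of_isClosed isClosed_closure isClosed_Ici
  have hK_compact : IsCompact K :=
    (hD_bdd.isCompact_closure).of_isClosed_subset hK_closed Set.inter_subset_left
  have hKD : K ⊆ D := by
    intro x hx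
    by_contra hxD
    have : x ∈ frontier D := ⟨hx.1, by rwa [hD_open.interior_eq]⟩
    have h1 : ε ≤ u x := hx.2
    linarith [hu_bd x this]
  have hw0 : ∀ x ∉ K, w x = 0 := by
    intro x hx
    by_cases hxD : x ∈ D
    · rw [hw, Set.indicator_of_mem hxD]
      refine hφ0 _ (le_of_not_ge fun h => hx ⟨subset_closure hxD, h⟩)
    · exact Set.indicator_of_notMem hxD _
  have hw_near : ∀ x ∉ K, w =ᶠ[nhds x] fun _ => 0 := fun x hx => by
    filter_upwards [hK_closed.isOpen_compl.mem_nhds hx] with y hy using hw0 y hy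
  have hw_D : ∀ x ∈ D, w =ᶠ[nhds x] φ ∘ u := fun x hx => by
    filter_upwards [hD_open.mem_nhds hx] with y hy using Set.indicator_of_mem hy _
  have hu_at : ∀ x ∈ D, ContDiffAt ℝ 2 u x := fun x hx => hu_C2.contDiffAt (hD_open.mem_nhds hx)
  refine ⟨w, ?_, HasCompactSupport.intro hK_compact hw0, ?_, ?_, ?_⟩
  · rw [contDiff_iff_contDiffAt]
    intro x
    by_cases hx : x ∈ D
    · exact (hφ.contDiffAt.comp x (hu_at x hx)).congr_of_eventuallyEq (hw_D x hx)
    · exact contDiffAt_const.congr_of_eventuallyEq (hw_near x fun h => hx (hKD h))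
  · intro x hx
    rw [hw, Set.indicator_of_mem hx]
    exact hφ_ge _
  · intro x hx
    rw [planeLaplacian_congr (hw_D x hx), planeLaplacian_comp hφ (hu_at x hx)]
    have h1 : 0 ≤ deriv (deriv φ) (u x) *
        ∑ i : Fin 2, (fderiv ℝ u x (EuclideanSpace.single i 1)) ^ 2 :=
      mul_nonneg (hφ_convex _) (Finset.sum_nonneg fun i _ => sq_nonneg _)
    have h2 : -(deriv φ (u x) * planeLaplacian u x) ≤ |planeLaplacian u x| := by
      refine (neg_le_abs _).trans ?_
      rw [abs_mul, abs_of_nonneg (hφ_nonneg _)]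
      exact mul_le_of_le_one_left (abs_nonneg _) (hφ_le _)
    linarith
  · intro x hx
    rw [planeLaplacian_congr (hw_near x fun h => hx (hKD h))]
    simp [planeLaplacian]

theorem exp_integral_mul_le {α : Type*} [MeasurableSpace α] {μ : Measure α} {p g : α → ℝ}
    (hp : 0 ≤ᵐ[μ] p) (hp1 : ∫ a, p a ∂μ = 1) (hpg : Integrable (fun a => p a * g a) μ)
    (hpe : Integrable (fun a => p a * exp (g a)) μ) :
    exp (∫ a, p a * g a ∂μ) ≤ ∫ a, p a * exp (g a) ∂μ := by
  set m := ∫ a, p a * g a ∂μ with hm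
  have hpi : Integrable p μ := integrable_of_integral_eq_one hp1
  have h : ∫ a, exp m * (p a * (1 - m) + p a * g a) ∂μ = exp m := by
    rw [integral_const_mul, integral_add (hpi.mul_const _) hpg, integral_mul_const, hp1]
    simp [← hm]
  rw [← h]
  refine integral_mono_ae (((hpi.mul_const _).add hpg).const_mul _) hpe ?_
  filter_upwards [hp] with a ha
  have h1 : exp m * (1 - m + g a) ≤ exp (g a) := by
    have := mul_le_mul_of_nonneg_left (add_one_le_exp (g a - m)) (exp_pos m).le
    rw [← exp_add, add_sub_cancel] at this
    linarith
  calc exp m * (p a * (1 - m) + p a * g a) = p a * (exp m * (1 - m + g a)) := by ring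
    _ ≤ p a * exp (g a) := mul_le_mul_of_nonneg_left h1 ha

theorem lintegral_closedBall_div_rpow {d a : ℝ} (hd : 0 < d) (ha : a < 2)
    (y : EuclideanSpace ℝ (Fin 2)) :
    ∫⁻ x in Metric.closedBall y d, ENNReal.ofReal ((d / ‖x - y‖) ^ a) =
      ENNReal.ofReal (2 * π * d ^ 2 / (2 - a)) := by
  set k : ℝ → ℝ := (Set.Iic d).indicator fun r => (d / r) ^ a with hk
  have hk_nonneg (r : ℝ) (hr : 0 ≤ r) : 0 ≤ k r :=
    Set.indicator_apply_nonneg fun _ => by positivity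
  have heq : Set.EqOn (fun r : ℝ => r ^ (2 - 1) • k r)
      ((Set.Iic d).indicator fun r => d ^ a * r ^ (1 - a)) (Set.Ioi 0) := by
    intro r hr
    have hr : 0 < r := hr
    by_cases h : r ∈ Set.Iic d
    · simp only [hk, Set.indicator_of_mem h]
      rw [div_rpow hd.le hr.le, rpow_sub hr, rpow_one]
      simp
      ring
    · simp only [hk, Set.indicator_of_notMem h]
      simp
  have hint : IntegrableOn (fun r : ℝ => d ^ a * r ^ (1 - a)) (Set.Ioc 0 d) := by
    have := (intervalIntegral.intervalIntegrable_rpow' (a := 0) (b := d) (r := 1 - a)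
      (by linarith)).const_mul (d ^ a)
    rwa [intervalIntegrable_iff_integrableOn_Ioc_of_le hd.le] at this
  have hinter : Set.Ioi (0 : ℝ) ∩ Set.Iic d = Set.Ioc 0 d := Set.Ioi_inter_Iic
  have hk_int : Integrable (fun z : EuclideanSpace ℝ (Fin 2) => k ‖z‖) := by
    rw [integrable_fun_norm_addHaar, finrank_euclideanSpace_fin,
      integrableOn_congr_fun heq measurableSet_Ioi, IntegrableOn,
      integrable_indicator_iff measurableSet_Iic, IntegrableOn,
      Measure.restrict_restrict measurableSet_Iic, Set.inter_comm, hinter]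
    exact hint
  have hk_val : ∫ z : EuclideanSpace ℝ (Fin 2), k ‖z‖ = 2 * π * d ^ 2 / (2 - a) := by
    rw [integral_fun_norm_addHaar, finrank_euclideanSpace_fin,
      setIntegral_congr_fun measurableSet_Ioi heq, setIntegral_indicator measurableSet_Iic, hinter,
      ← intervalIntegral.integral_of_le hd.le, intervalIntegral.integral_const_mul,
      integral_rpow (Or.inl (by linarith)), volume_real_ball_zero_one, zero_rpow (by linarith),
      sub_zero,
      show 1 - a + 1 = 2 - a by ring, ← mul_div_assoc, ← rpow_add hd,
      show a + (2 - a) = (2 : ℕ) by push_cast; ring, rpow_natCast]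
    simp
    ring
  rw [← hk_val, ofReal_integral_eq_lintegral_ofReal hk_int
    (.of_forall fun z => hk_nonneg _ (norm_nonneg z)),
    ← lintegral_sub_right_eq_self (fun z => ENNReal.ofReal (k ‖z‖)) y,
    ← lintegral_indicator Metric.isClosed_closedBall.measurableSet]
  congr 1 with x
  by_cases h : x ∈ Metric.closedBall y d
  · have : ‖x - y‖ ∈ Set.Iic d := by simpa [dist_eq_norm] using h
    simp only [hk, Set.indicator_of_mem h, Set.indicator_of_mem this]
  · have : ‖x - y‖ ∉ Set.Iic d := by simpa [dist_eq_norm] using h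
    simp only [hk, Set.indicator_of_notMem h, Set.indicator_of_notMem this, ENNReal.ofReal_zero]

theorem ofReal_exp_le_lintegral_of_contDiff {D : Set (EuclideanSpace ℝ (Fin 2))}
    (hD_meas : MeasurableSet D) (hD_bdd : Bornology.IsBounded D)
    {f w : EuclideanSpace ℝ (Fin 2) → ℝ} (hf : IntegrableOn f D) (hf_pos : 0 < ∫ x in D, |f x|)
    (hw : ContDiff ℝ 2 w) (hw_supp : HasCompactSupport w)
    (hwf : ∀ x ∈ D, -planeLaplacian w x ≤ |f x|) (hw0 : ∀ x ∉ D, planeLaplacian w x = 0)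
    {a : ℝ} (ha : 0 ≤ a) {x : EuclideanSpace ℝ (Fin 2)} (hx : x ∈ D) :
    ENNReal.ofReal (exp (a * (2 * π * w x) / ∫ y in D, |f y|)) ≤
      ∫⁻ y in D, ENNReal.ofReal (|f y| / ∫ z in D, |f z|) *
        ENNReal.ofReal ((Metric.diam D / ‖x - y‖) ^ a) := by
  set F := ∫ y in D, |f y| with hF
  set d := Metric.diam D with hd
  have hdist : ∀ y ∈ D, ‖x - y‖ ≤ d := fun y hy => by
    rw [← dist_eq_norm]; exact Metric.dist_le_diam_of_mem hD_bdd hx hy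
  have hlim : Filter.Tendsto (fun c : ℝ => ENNReal.ofReal (exp (a *
      (∫ y, (2 * c ^ 2 / (1 + c ^ 2 * ‖x - y‖ ^ 2) ^ 2) * w y) / F))) Filter.atTop
      (nhds (ENNReal.ofReal (exp (a * (2 * π * w x) / F)))) :=
    ENNReal.tendsto_ofReal ((continuous_exp.tendsto _).comp
      (((tendsto_integral_peak hw.continuous
        (hw.continuous.integrable_of_hasCompactSupport hw_supp) x).const_mul a).div_const F))
  refine le_of_tendsto' hlim fun c => ?_
  have hG_cont : Continuous (logKernel c d x) := (contDiff_logKernel c d x).continuous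
  have hG_bdd : ∀ y ∈ D, ‖logKernel c d x y‖ ≤ (1 / 2) * log (1 + c ^ 2 * d ^ 2) := fun y hy => by
    rw [norm_eq_abs, abs_of_nonneg (logKernel_nonneg (hdist y hy))]
    exact logKernel_le x y
  have hfabs : IntegrableOn (fun y => |f y|) D := hf.abs
  have hGf : IntegrableOn (fun y => |f y| * logKernel c d x y) D :=
    hfabs.mul_bdd hG_cont.aestronglyMeasurable
      ((ae_restrict_iff' hD_meas).2 (.of_forall hG_bdd))
  have hlap : Integrable (fun y => logKernel c d x y * -planeLaplacian w y) := by
    refine (hG_cont.mul (continuous_planeLaplacian hw).neg).integrable_of_hasCompactSupport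
      (HasCompactSupport.mul_left (HasCompactSupport.neg ?_))
    refine HasCompactSupport.intro hw_supp fun y hy => ?_
    rw [planeLaplacian_congr (notMem_tsupport_iff_eventuallyEq.1 hy)]
    simp [planeLaplacian]
  have hint : ∫ y, (2 * c ^ 2 / (1 + c ^ 2 * ‖x - y‖ ^ 2) ^ 2) * w y ≤
      ∫ y in D, |f y| * logKernel c d x y := by
    calc ∫ y, (2 * c ^ 2 / (1 + c ^ 2 * ‖x - y‖ ^ 2) ^ 2) * w y
        = -∫ y, planeLaplacian (logKernel c d x) y * w y := by
          simp only [planeLaplacian_logKernel, neg_mul, integral_neg, neg_neg]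
      _ = ∫ y, logKernel c d x y * -planeLaplacian w y := by
          rw [← integral_mul_planeLaplacian_eq (contDiff_logKernel c d x) hw hw_supp,
            ← integral_neg]
          simp only [mul_neg]
      _ = ∫ y in D, logKernel c d x y * -planeLaplacian w y :=
          (setIntegral_eq_integral_of_forall_compl_eq_zero fun y hy => by simp [hw0 y hy]).symm
      _ ≤ ∫ y in D, |f y| * logKernel c d x y := by
          refine setIntegral_mono_on hlap.integrableOn hGf hD_meas fun y hy => ?_
          rw [mul_comm]
          exact mul_le_mul_of_nonneg_right (hwf y hy) (logKernel_nonneg (hdist y hy))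
  have hpG : IntegrableOn (fun y => |f y| / F * (a * logKernel c d x y)) D := by
    refine (hGf.const_mul (a / F)).congr (.of_forall fun y => ?_)
    ring
  have hpe : IntegrableOn (fun y => |f y| / F * exp (a * logKernel c d x y)) D := by
    refine Integrable.mul_bdd (c := exp (a * ((1 / 2) * log (1 + c ^ 2 * d ^ 2))))
      (hfabs.div_const F) (by fun_prop) (.of_forall fun y => ?_)
    rw [norm_eq_abs, abs_exp]
    exact exp_le_exp.2 (mul_le_mul_of_nonneg_left (logKernel_le x y) ha)
  have hp_nonneg (y) : 0 ≤ |f y| / F := by positivity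
  have hjensen := exp_integral_mul_le (μ := volume.restrict D) (.of_forall hp_nonneg)
    (by rw [integral_div, div_self hf_pos.ne']) hpG hpe
  calc ENNReal.ofReal (exp (a * (∫ y, (2 * c ^ 2 / (1 + c ^ 2 * ‖x - y‖ ^ 2) ^ 2) * w y) / F))
      ≤ ENNReal.ofReal (∫ y in D, |f y| / F * exp (a * logKernel c d x y)) := by
        refine ENNReal.ofReal_le_ofReal (le_trans (exp_le_exp.2 ?_) hjensen)
        calc a * (∫ y, (2 * c ^ 2 / (1 + c ^ 2 * ‖x - y‖ ^ 2) ^ 2) * w y) / F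
            ≤ a * (∫ y in D, |f y| * logKernel c d x y) / F := by gcongr
          _ = ∫ y in D, |f y| / F * (a * logKernel c d x y) := by
            rw [mul_div_right_comm, ← integral_const_mul]
            congr 1 with y
            ring
    _ = ∫⁻ y in D, ENNReal.ofReal (|f y| / F * exp (a * logKernel c d x y)) :=
        ofReal_integral_eq_lintegral_ofReal hpe (.of_forall fun y => by positivity)
    _ ≤ ∫⁻ y in D, ENNReal.ofReal (|f y| / F) * ENNReal.ofReal ((d / ‖x - y‖) ^ a) := by
        refine lintegral_mono_ae ?_
        filter_upwards [ae_restrict_mem hD_meas,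
          ae_restrict_of_ae (Measure.ae_ne volume x)] with y hy hyx
        rw [← ENNReal.ofReal_mul (hp_nonneg y)]
        have hr : 0 < ‖x - y‖ := norm_pos_iff.2 (sub_ne_zero.2 hyx.symm)
        rw [rpow_def_of_pos (div_pos (hr.trans_le (hdist y hy)) hr), mul_comm (log _)]
        gcongr
        exact logKernel_le_log hyx.symm (hdist y hy)

theorem ofReal_exp_le_lintegral {D : Set (EuclideanSpace ℝ (Fin 2))} (hD_open : IsOpen D)
    (hD_bdd : Bornology.IsBounded D) {f u : EuclideanSpace ℝ (Fin 2) → ℝ}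
    (hf : IntegrableOn f D) (hf_pos : 0 < ∫ x in D, |f x|) (hu_cont : ContinuousOn u (closure D))
    (hu_C2 : ContDiffOn ℝ 2 u D) (huf : ∀ x ∈ D, |planeLaplacian u x| = |f x|)
    (hu_bd : ∀ x ∈ frontier D, u x = 0)
    {a : ℝ} (ha : 0 ≤ a) {x : EuclideanSpace ℝ (Fin 2)} (hx : x ∈ D) :
    ENNReal.ofReal (exp (a * (2 * π * u x) / ∫ y in D, |f y|)) ≤
      ∫⁻ y in D, ENNReal.ofReal (|f y| / ∫ z in D, |f z|) *
        ENNReal.ofReal ((Metric.diam D / ‖x - y‖) ^ a) := by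
  have hcont : Continuous fun ε : ℝ =>
      ENNReal.ofReal (exp (a * (2 * π * (u x - 2 * ε)) / ∫ y in D, |f y|)) :=
    ENNReal.continuous_ofReal.comp (by fun_prop)
  have hlim := (hcont.tendsto 0).mono_left (nhdsWithin_le_nhds (s := Set.Ioi 0))
  simp only [mul_zero, sub_zero] at hlim
  refine le_of_tendsto hlim ?_
  filter_upwards [self_mem_nhdsWithin] with ε hε
  obtain ⟨w, hw, hw_supp, hw_ge, hw_lap, hw0⟩ :=
    exists_contDiff_hasCompactSupport_approx hD_open hD_bdd hu_cont hu_C2 hu_bd hε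
  refine le_trans ?_ (ofReal_exp_le_lintegral_of_contDiff hD_open.measurableSet hD_bdd hf hf_pos hw
    hw_supp (fun y hy => (hw_lap y hy).trans_eq (huf y hy)) hw0 ha hx)
  have := hw_ge x hx
  gcongr

/-- The Brezis–Merle inequality for classical solutions of `-Δu = f` in a bounded open
set `D ⊂ ℝ²` with `u = 0` on `∂D`. -/
theorem brezis_merle_inequality
    (D : Set (EuclideanSpace ℝ (Fin 2))) (hD_open : IsOpen D)
    (hD_bdd : Bornology.IsBounded D)
    (f u : EuclideanSpace ℝ (Fin 2) → ℝ)
    (hf : IntegrableOn f D)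
    (hf_pos : 0 < ∫ x in D, |f x|)
    (hu_cont : ContinuousOn u (closure D))
    (hu_C2 : ContDiffOn ℝ 2 u D)
    (huf : ∀ x ∈ D,
      -(∑ i : Fin 2, fderiv ℝ (fun y => fderiv ℝ u y (EuclideanSpace.single i 1)) x
          (EuclideanSpace.single i 1)) = f x)
    (hu_bd : ∀ x ∈ frontier D, u x = 0)
    (δ : ℝ) (hδ : δ ∈ Set.Ioo 0 (4 * π)) :
    ∫ x in D, Real.exp ((4 * π - δ) * |u x| / ∫ y in D, |f y|)
      ≤ (4 * π ^ 2 / δ) * (Metric.diam D) ^ 2 := by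
  obtain ⟨hδ0, hδπ⟩ := hδ
  set F := ∫ y in D, |f y| with hF
  set d := Metric.diam D with hd
  have hD_meas : MeasurableSet D := hD_open.measurableSet
  set a : ℝ := 2 - δ / (2 * π) with ha_def
  have haδ : a * (2 * π) = 4 * π - δ := by rw [ha_def]; field_simp; ring
  have ha0 : 0 ≤ a := by
    rw [ha_def, sub_nonneg, div_le_iff₀ (by positivity)]; linarith
  have ha2 : a < 2 := by rw [ha_def, sub_lt_self_iff]; positivity
  have hd0 : 0 < d := by
    have hne : D.Nonempty := by
      rw [Set.nonempty_iff_ne_empty]; rintro rfl; simp [hF] at hf_pos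
    obtain ⟨z, hz⟩ := hne
    refine Metric.diam_pos ?_ hD_bdd
    by_contra h
    have hsub : D = {z} := (Set.not_nontrivial_iff.1 h).eq_singleton_of_mem hz
    rw [hsub] at hD_open
    exact not_isOpen_singleton z hD_open
  have hlap : ∀ x ∈ D, |planeLaplacian u x| = |f x| := fun x hx => by
    rw [← huf x hx, abs_neg]; rfl
  have hpoint : ∀ x ∈ D, ENNReal.ofReal (exp ((4 * π - δ) * |u x| / F)) ≤
      ∫⁻ y in D, ENNReal.ofReal (|f y| / F) * ENNReal.ofReal ((d / ‖x - y‖) ^ a) := by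
    intro x hx
    rw [← haδ, mul_assoc]
    rcases abs_choice (u x) with h | h <;> rw [h]
    · exact ofReal_exp_le_lintegral hD_open hD_bdd hf hf_pos hu_cont hu_C2 hlap hu_bd ha0 hx
    · refine ofReal_exp_le_lintegral (u := -u) hD_open hD_bdd hf hf_pos hu_cont.neg hu_C2.neg
        (fun y hy => ?_) (fun y hy => ?_) ha0 hx
      · rw [planeLaplacian_neg, abs_neg, hlap y hy]
      · simp [hu_bd y hy]
  have hp_meas : AEMeasurable (fun y => ENNReal.ofReal (|f y| / F)) (volume.restrict D) :=
    (hf.abs.div_const F).aemeasurable.ennreal_ofReal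
  have hp_one : ∫⁻ y in D, ENNReal.ofReal (|f y| / F) = 1 := by
    rw [← ofReal_integral_eq_lintegral_ofReal (hf.abs.div_const F)
      (.of_forall fun y => by positivity), integral_div, div_self hf_pos.ne', ENNReal.ofReal_one]
  have hker_meas : Measurable fun z : EuclideanSpace ℝ (Fin 2) × EuclideanSpace ℝ (Fin 2) =>
      ENNReal.ofReal ((d / ‖z.1 - z.2‖) ^ a) := by fun_prop
  have hmain : ∫⁻ x in D, ENNReal.ofReal (exp ((4 * π - δ) * |u x| / F)) ≤
      ENNReal.ofReal ((4 * π ^ 2 / δ) * d ^ 2) := by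
    calc ∫⁻ x in D, ENNReal.ofReal (exp ((4 * π - δ) * |u x| / F))
        ≤ ∫⁻ x in D, ∫⁻ y in D, ENNReal.ofReal (|f y| / F) *
            ENNReal.ofReal ((d / ‖x - y‖) ^ a) := setLIntegral_mono' hD_meas hpoint
      _ = ∫⁻ y in D, ∫⁻ x in D, ENNReal.ofReal (|f y| / F) *
            ENNReal.ofReal ((d / ‖x - y‖) ^ a) :=
          lintegral_lintegral_swap (hp_meas.comp_snd.mul hker_meas.aemeasurable)
      _ ≤ ∫⁻ y in D, ENNReal.ofReal (|f y| / F) * ENNReal.ofReal ((4 * π ^ 2 / δ) * d ^ 2) := by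
          refine setLIntegral_mono_ae' hD_meas (.of_forall fun y hy => ?_)
          rw [lintegral_const_mul' _ _ ENNReal.ofReal_ne_top]
          gcongr
          have hsub : D ⊆ Metric.closedBall y d := fun x hx =>
            Metric.dist_le_diam_of_mem hD_bdd hx hy
          refine (lintegral_mono_set hsub).trans_eq ?_
          rw [lintegral_closedBall_div_rpow hd0 ha2, ha_def, sub_sub_cancel]
          congr 1
          field_simp
          norm_num
      _ = ENNReal.ofReal ((4 * π ^ 2 / δ) * d ^ 2) := by
          rw [lintegral_mul_const' _ _ ENNReal.ofReal_ne_top, hp_one, one_mul]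
  have hu_meas : AEStronglyMeasurable (fun x => exp ((4 * π - δ) * |u x| / F))
      (volume.restrict D) := by
    have : ContinuousOn (fun x => exp ((4 * π - δ) * |u x| / F)) D :=
      (((hu_cont.mono subset_closure).abs.const_mul _).div_const F).rexp
    exact this.aestronglyMeasurable hD_meas
  rw [integral_eq_lintegral_of_nonneg_ae (.of_forall fun x => (exp_pos _).le) hu_meas]
  exact ENNReal.toReal_le_of_le_ofReal (by positivity) hmain
end

section
/- Let (Ω, μ) be a measure space with μ(Ω) < ∞, let P be a Borel probability measure on ℝ, and let v : Ω → ℝ be measurable. Let ε > 0 and α₊* > 2ε, let α ∈ (0, α₊* - 2ε], set p = (α₊* - ε)/(α₊* - 2ε) and J = [α₊* - ε, α₊*], and assume P(J) > 0. Then ∫_Ω exp(p·α·v(x)) dμ(x) ≤ μ(Ω) + (1/P(J)) · ∫_ℝ ( ∫_Ω exp(α'·v(x)) dμ(x) ) dP(α'), where all integrals are taken in the extended nonnegative reals. -/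
open MeasureTheory ENNReal

/-- If `0 ≤ a ≤ b` then `e^{at} ≤ 1 + e^{bt}` for every real `t`. -/
theorem exp_mul_le_one_add_exp_mul {a b : ℝ} (ha : 0 ≤ a) (hab : a ≤ b) (t : ℝ) :
    Real.exp (a * t) ≤ 1 + Real.exp (b * t) := by
  rcases le_total t 0 with ht | ht
  · have : Real.exp (a * t) ≤ 1 :=
      Real.exp_le_one_iff.2 (mul_nonpos_of_nonneg_of_nonpos ha ht)
    linarith [Real.exp_pos (b * t)]
  · have : Real.exp (a * t) ≤ Real.exp (b * t) := by gcongr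
    linarith

/-- Integrated form of `exp_mul_le_one_add_exp_mul`. -/
theorem lintegral_exp_mul_le {Ω : Type*} [MeasurableSpace Ω] (μ : Measure Ω) (v : Ω → ℝ)
    {a b : ℝ} (ha : 0 ≤ a) (hab : a ≤ b) :
    ∫⁻ x, ENNReal.ofReal (Real.exp (a * v x)) ∂μ
      ≤ μ Set.univ + ∫⁻ x, ENNReal.ofReal (Real.exp (b * v x)) ∂μ := by
  calc ∫⁻ x, ENNReal.ofReal (Real.exp (a * v x)) ∂μ
      ≤ ∫⁻ x, (1 + ENNReal.ofReal (Real.exp (b * v x))) ∂μ := by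
        refine lintegral_mono fun x => ?_
        rw [← ENNReal.ofReal_one, ← ENNReal.ofReal_add zero_le_one (Real.exp_pos _).le]
        exact ENNReal.ofReal_le_ofReal (exp_mul_le_one_add_exp_mul ha hab _)
    _ = μ Set.univ + ∫⁻ x, ENNReal.ofReal (Real.exp (b * v x)) ∂μ := by
        rw [lintegral_add_left measurable_const, lintegral_one]

/-- Averaging a pointwise lower bound over a set of positive finite measure. -/
theorem le_one_div_measure_mul_lintegral {β : Type*} [MeasurableSpace β] (P : Measure β)
    [IsFiniteMeasure P] {s : Set β} (hs : MeasurableSet s) (hPs : 0 < P s) {c : ℝ≥0∞}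
    {F : β → ℝ≥0∞} (hF : ∀ b ∈ s, c ≤ F b) : c ≤ (1 / P s) * ∫⁻ b, F b ∂P := by
  have h : c * P s ≤ ∫⁻ b, F b ∂P :=
    calc c * P s = ∫⁻ _ in s, c ∂P := (setLIntegral_const s c).symm
      _ ≤ ∫⁻ b in s, F b ∂P := setLIntegral_mono' hs hF
      _ ≤ ∫⁻ b, F b ∂P := setLIntegral_le_lintegral s F
  rw [one_div, mul_comm, ← div_eq_mul_inv]
  exact (ENNReal.le_div_iff_mul_le (Or.inl hPs.ne') (Or.inl (measure_ne_top P s))).2 h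

/-- The key estimate of Section 4 (leading to (4.3)–(4.5)): a uniform `L^{p_ε}`
bound for `e^{αv}` in terms of `∬ e^{α'v}`. -/
theorem exp_lp_bound
    {Ω : Type*} [MeasurableSpace Ω] (μ : Measure Ω) (hμ : μ Set.univ < ⊤)
    (P : Measure ℝ) [IsProbabilityMeasure P]
    (v : Ω → ℝ) (hv : Measurable v)
    (ε αstar : ℝ) (hε : 0 < ε) (hαstar : αstar > 2 * ε)
    (α : ℝ) (hα : α ∈ Set.Ioc (0 : ℝ) (αstar - 2 * ε))
    (p : ℝ) (hp : p = (αstar - ε) / (αstar - 2 * ε))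
    (J : Set ℝ) (hJ : J = Set.Icc (αstar - ε) αstar)
    (hPJ : 0 < P J) :
    (∫⁻ x, ENNReal.ofReal (Real.exp (p * α * v x)) ∂μ)
      ≤ μ Set.univ +
        (1 / P J) * ∫⁻ α', (∫⁻ x, ENNReal.ofReal (Real.exp (α' * v x)) ∂μ) ∂P := by
  subst hp hJ
  have hd : 0 < αstar - 2 * ε := by linarith
  have hn : 0 < αstar - ε := by linarith
  have h0 : 0 ≤ (αstar - ε) / (αstar - 2 * ε) * α :=
    mul_nonneg (div_pos hn hd).le hα.1.le
  have h1 : (αstar - ε) / (αstar - 2 * ε) * α ≤ αstar - ε := by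
    rw [div_mul_eq_mul_div, div_le_iff₀ hd]
    exact mul_le_mul_of_nonneg_left hα.2 hn.le
  rw [← tsub_le_iff_left]
  refine le_one_div_measure_mul_lintegral P measurableSet_Icc hPJ fun b hb => ?_
  exact tsub_le_iff_left.2 (lintegral_exp_mul_le μ v h0 (h1.trans hb.1))
end
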